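/- Let n ≥ 1 be an integer and let G be a holomorphic function on a neighborhood of 0 ∈ ℂ such that G(z) = 1 + a z^(n+1) + O(z^(n+2)) as z → 0, for some a ∈ ℂ with a ≠ 0. On a punctured neighborhood of 0 where G and G' do not vanish, define ρ = G'''/G' + G''/(2G) − 3(G')²/(4G²) − 7(G'')²/(4(G')²). Then lim_{z→0} z² ρ(z) = −(3n² + 4n)/4. (This is the analytic content of the statement that at an isolated umbilic point where the Hopf differential vanishes to order n — so the Weierstrass data can be normalized to height differential η = dz and Gauss map G = 1 + a z^(n+1) + ... — the entropy differential P = (ρ/2) dz² has a double pole with leading coefficient −(3n² + 4n)/8.) -/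

import Mathlib

open Filter Asymptotics

/-- The coefficient `ρ[G,1]` of the entropy differential `P = (ρ/2) dz²` for
Weierstrass data with height differential `η = dz` and Gauss map `G`. -/
noncomputable def rhoUmbilic (G : ℂ → ℂ) (z : ℂ) : ℂ :=
  deriv (deriv (deriv G)) z / deriv G z
    + deriv (deriv G) z / (2 * G z)
    - 3 * (deriv G z) ^ 2 / (4 * (G z) ^ 2)
    - 7 * (deriv (deriv G) z) ^ 2 / (4 * (deriv G z) ^ 2)

open scoped Topology in
/-- A holomorphic function of the form `1 + a z ^ k + O(z ^ (k + 1))` is `1 + z ^ k g` off the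
origin, with `g` analytic at the origin and `g 0 = a`. -/
lemma exists_analyticAt_eq_one_add_pow_mul {G : ℂ → ℂ} {a : ℂ} {k : ℕ}
    (hG : AnalyticAt ℂ G 0)
    (hexp : (fun z : ℂ => G z - 1 - a * z ^ k) =O[𝓝 0] fun z : ℂ => z ^ (k + 1)) :
    ∃ g : ℂ → ℂ, AnalyticAt ℂ g 0 ∧ g 0 = a ∧ G =ᶠ[𝓝[≠] 0] fun z => 1 + z ^ k * g z := by
  refine ⟨Function.update (fun z => (G z - 1) / z ^ k) 0 a, ?_, by simp, ?_⟩
  · apply Complex.analyticAt_of_differentiable_on_punctured_nhds_of_continuousAt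
    · filter_upwards [self_mem_nhdsWithin, hG.eventually_analyticAt.filter_mono nhdsWithin_le_nhds]
        with z hz hGz
      have hz0 : z ≠ 0 := hz
      have hd : DifferentiableAt ℂ (fun z => (G z - 1) / z ^ k) z :=
        (hGz.differentiableAt.sub_const 1).div (by fun_prop) (pow_ne_zero k hz0)
      refine hd.congr_of_eventuallyEq ?_
      filter_upwards [isOpen_ne.mem_nhds hz0] with w hw
      exact Function.update_of_ne hw _ _
    · rw [continuousAt_update_same]
      have hO : (fun z : ℂ => (G z - 1) / z ^ k - a) =O[𝓝[≠] 0] fun z : ℂ => z := by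
        have h := (hexp.mono (nhdsWithin_le_nhds (s := {0}ᶜ))).mul
          (isBigO_refl (fun z : ℂ => (z ^ k)⁻¹) _)
        refine h.congr' ?_ ?_ <;> filter_upwards [self_mem_nhdsWithin] with z hz
        · have hz0 : z ≠ 0 := hz
          field_simp
        · have hz0 : z ≠ 0 := hz
          field_simp
          ring
      exact tendsto_sub_nhds_zero_iff.1
        (hO.trans_tendsto (tendsto_id.mono_left nhdsWithin_le_nhds))
  · filter_upwards [self_mem_nhdsWithin] with z hz
    have hz0 : z ≠ 0 := hz
    rw [Function.update_of_ne hz0]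
    field_simp
    ring

open scoped Topology in
/-- The Euler operator `z d/dz` maps `c + z ^ k g` to `z ^ k (k g + z dg/dz)`. -/
lemma exists_analyticAt_mul_deriv_eq_pow_mul {f g : ℂ → ℂ} {c : ℂ} {k : ℕ}
    (hg : AnalyticAt ℂ g 0) (hf : f =ᶠ[𝓝[≠] 0] fun z => c + z ^ k * g z) :
    ∃ g₁ : ℂ → ℂ, AnalyticAt ℂ g₁ 0 ∧ g₁ 0 = k * g 0 ∧
      ∀ᶠ z in 𝓝[≠] 0, z * deriv f z = z ^ k * g₁ z := by
  refine ⟨fun z => k * g z + z * deriv g z,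
    (analyticAt_const.mul hg).add (analyticAt_id.mul hg.deriv), by simp, ?_⟩
  filter_upwards [hf.nhdsNE_deriv, hg.eventually_analyticAt.filter_mono nhdsWithin_le_nhds]
    with z hz hgz
  have hd : HasDerivAt (fun z => c + z ^ k * g z)
      ((k : ℂ) * z ^ (k - 1) * g z + z ^ k * deriv g z) z :=
    ((hasDerivAt_pow k z).mul hgz.differentiableAt.hasDerivAt).const_add c
  rw [hz, hd.deriv]
  cases k with
  | zero => simp
  | succ k => simp only [Nat.add_sub_cancel]; ring

open scoped Topology in
/-- The derivative of `c + z ^ (k + 1) g` is `z ^ k` times an analytic function. -/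
lemma exists_analyticAt_deriv_eq_pow_mul {f g : ℂ → ℂ} {c : ℂ} {k : ℕ}
    (hg : AnalyticAt ℂ g 0) (hf : f =ᶠ[𝓝[≠] 0] fun z => c + z ^ (k + 1) * g z) :
    ∃ g₁ : ℂ → ℂ, AnalyticAt ℂ g₁ 0 ∧ g₁ 0 = (k + 1) * g 0 ∧
      deriv f =ᶠ[𝓝[≠] 0] fun z => 0 + z ^ k * g₁ z := by
  obtain ⟨g₁, hg₁, h0, h⟩ := exists_analyticAt_mul_deriv_eq_pow_mul hg hf
  refine ⟨g₁, hg₁, by simpa using h0, ?_⟩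
  filter_upwards [h, self_mem_nhdsWithin] with z hz hz0
  refine mul_left_cancel₀ (show z ≠ 0 from hz0) ?_
  rw [hz]
  ring

/-- At an isolated umbilic point, normalized so `G(z) = 1 + a z^(n+1) + O(z^(n+2))`
with `a ≠ 0`, the entropy coefficient `ρ` satisfies `z² ρ(z) → -(3n² + 4n)/4` as
`z → 0`; i.e. `P = (ρ/2) dz²` has a double pole with leading coefficient
`-(3n² + 4n)/8`. -/
theorem entropy_double_pole_at_umbilic
    (n : ℕ) (hn : 1 ≤ n) (U : Set ℂ) (hU : IsOpen U) (h0 : (0 : ℂ) ∈ U)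
    (G : ℂ → ℂ) (hG : DifferentiableOn ℂ G U)
    (a : ℂ) (ha : a ≠ 0)
    (hexp : (fun z : ℂ => G z - 1 - a * z ^ (n + 1)) =O[nhds 0]
      fun z : ℂ => z ^ (n + 2)) :
    Tendsto (fun z : ℂ => z ^ 2 * rhoUmbilic G z) (nhdsWithin 0 {0}ᶜ)
      (nhds (-(3 * (n : ℂ) ^ 2 + 4 * (n : ℂ)) / 4)) := by
  have hGa : AnalyticAt ℂ G 0 := hG.analyticAt (hU.mem_nhds h0)
  obtain ⟨m, rfl⟩ : ∃ m, n = m + 1 := ⟨n - 1, by omega⟩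
  obtain ⟨g, hg, hga, hGg⟩ := exists_analyticAt_eq_one_add_pow_mul hGa hexp
  obtain ⟨g₁, hg₁, hg₁0, hG₁⟩ := exists_analyticAt_deriv_eq_pow_mul hg hGg
  obtain ⟨g₂, hg₂, hg₂0, hG₂⟩ := exists_analyticAt_deriv_eq_pow_mul hg₁ hG₁
  obtain ⟨g₃, hg₃, hg₃0, hG₃⟩ := exists_analyticAt_mul_deriv_eq_pow_mul hg₂ hG₂
  have hm : (m : ℂ) + 1 + 1 ≠ 0 := by exact_mod_cast (m + 1).succ_ne_zero
  have hg₁ne : g₁ 0 ≠ 0 := by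
    rw [hg₁0, hga]
    push_cast
    exact mul_ne_zero hm ha
  have hcont : ContinuousAt (fun z => g₃ z / g₁ z
      + z ^ (m + 2) * g₂ z / (2 * (1 + z ^ (m + 2) * g z))
      - 3 * (z ^ (m + 2) * g₁ z) ^ 2 / (4 * (1 + z ^ (m + 2) * g z) ^ 2)
      - 7 * g₂ z ^ 2 / (4 * g₁ z ^ 2)) 0 := by
    have := hg.continuousAt
    have := hg₁.continuousAt
    have := hg₂.continuousAt
    have := hg₃.continuousAt
    fun_prop (disch := simp [hg₁ne])
  have hlim := hcont.tendsto.mono_left (nhdsWithin_le_nhds (s := {0}ᶜ))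
  have hval : (g₃ 0 / g₁ 0
      + (0 : ℂ) ^ (m + 2) * g₂ 0 / (2 * (1 + (0 : ℂ) ^ (m + 2) * g 0))
      - 3 * ((0 : ℂ) ^ (m + 2) * g₁ 0) ^ 2 / (4 * (1 + (0 : ℂ) ^ (m + 2) * g 0) ^ 2)
      - 7 * g₂ 0 ^ 2 / (4 * g₁ 0 ^ 2))
      = -(3 * ((m + 1 : ℕ) : ℂ) ^ 2 + 4 * ((m + 1 : ℕ) : ℂ)) / 4 := by
    rw [hg₃0, hg₂0]
    push_cast
    simp only [ne_eq, Nat.add_eq_zero_iff, OfNat.ofNat_ne_zero, and_false, not_false_eq_true,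
      zero_pow, zero_mul, mul_zero, zero_div, add_zero, sub_zero]
    field_simp
    ring
  rw [hval] at hlim
  refine hlim.congr' ?_
  filter_upwards [hGg, hG₁, hG₂, hG₃, self_mem_nhdsWithin,
    (hg₁.continuousAt.eventually_ne hg₁ne).filter_mono nhdsWithin_le_nhds]
    with z h h₁ h₂ h₃ hz hz₁
  have hz0 : z ≠ 0 := hz
  have h₃' : deriv (deriv (deriv G)) z = z ^ m * g₃ z / z := by
    rw [← h₃]
    field_simp
  simp only [rhoUmbilic, h, h₁, h₂, h₃', zero_add, mul_add, mul_sub]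
  congr 1
  · congr 1
    · congr 1
      · field_simp
        ring
      · ring
    · ring
  · field_simp
    ring
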